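/- arXiv:2111.12536 — 2 statements merged into one kernel-verified Lean document; each statement's English description precedes it below -/
import Mathlib

section
/- Fix positive integers d and n, and let ℳF be a set of POVMs with n outcomes on ℂ^d. For any POVM M, the projective robustness Ω_{ℳF}(M) is finite if and only if there exists a POVM N ∈ ℳF such that for every i, the range (column space) of N i equals the range of M i. (Theorem 6(i).) -/
open Matrix ComplexOrder

/-- A POVM with `n` outcomes on `ℂ^d`: a family of PSD matrices summing to `1`. -/
def IsPOVM {d n : ℕ} (M : Fin n → Matrix (Fin d) (Fin d) ℂ) : Prop :=
  (∀ i, (M i).PosSemidef) ∧ (∑ i, M i) = 1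

/-- The projective robustness of a tuple of effects `M` relative to a set `MF` of free
measurements: `Ω_{ℳF}(M) = inf {λ·μ : ∃ N ∈ ℳF, ∀ i, M i ≤ λ • N i ∧ N i ≤ μ • M i}`,
with `inf ∅ = ∞`; here `X ≤ Y` means `Y - X` is PSD. -/
noncomputable def OmegaM {d n : ℕ}
    (MF : Set (Fin n → Matrix (Fin d) (Fin d) ℂ))
    (M : Fin n → Matrix (Fin d) (Fin d) ℂ) : ENNReal :=
  sInf {γ : ENNReal | ∃ lam mu : ℝ, 0 ≤ lam ∧ 0 ≤ mu ∧
    (∃ N ∈ MF, ∀ i, (lam • N i - M i).PosSemidef ∧ (mu • M i - N i).PosSemidef) ∧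
    γ = ENNReal.ofReal (lam * mu)}

theorem aux_factor {d : ℕ} (R S : Matrix (Fin d) (Fin d) ℂ)
    (h : ∀ x, R *ᵥ x = 0 → S *ᵥ x = 0) : ∃ T, S = T * R := by
  let f := Matrix.toLin' R
  let g := Matrix.toLin' S
  have hle : LinearMap.ker f ≤ LinearMap.ker g := by
    intro x hx
    simp only [f, g, LinearMap.mem_ker, Matrix.toLin'_apply] at hx ⊢
    exact h x hx
  obtain ⟨u, hu⟩ := LinearMap.exists_leftInverse_of_injective
    ((LinearMap.ker f).liftQ f le_rfl) (Submodule.ker_liftQ_eq_bot _ _ _ le_rfl)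
  refine ⟨LinearMap.toMatrix' (((LinearMap.ker f).liftQ g hle).comp u), ?_⟩
  apply Matrix.toLin'.injective
  rw [Matrix.toLin'_mul, Matrix.toLin'_toMatrix']
  ext1 i
  ext1
  have h2 := LinearMap.congr_fun hu ((LinearMap.ker f).mkQ (Pi.single i 1))
  simp only [LinearMap.comp_apply, Submodule.mkQ_apply, Submodule.liftQ_apply,
    LinearMap.id_apply] at h2
  change g _ = ((LinearMap.ker f).liftQ g hle) (u (f _))
  rw [LinearMap.single_apply, h2, Submodule.liftQ_apply]

theorem aux_range {d : ℕ} {A B : Matrix (Fin d) (Fin d) ℂ} (hA : A.PosSemidef)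
    (hB : B.PosSemidef) (c : ℝ) (h : (c • B - A).PosSemidef) :
    LinearMap.range (Matrix.toLin' A) ≤ LinearMap.range (Matrix.toLin' B) := by
  obtain ⟨T, hT⟩ := aux_factor B A (by
    intro x hx
    rw [← hA.dotProduct_mulVec_zero_iff]
    have h1 := h.dotProduct_mulVec_nonneg x
    rw [Matrix.sub_mulVec, Matrix.smul_mulVec, hx, smul_zero, zero_sub, dotProduct_neg] at h1
    exact le_antisymm (neg_nonneg.mp h1) (hA.dotProduct_mulVec_nonneg x))
  have h2 : A = B * Tᴴ := by
    have := congrArg conjTranspose hT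
    rwa [conjTranspose_mul, hA.1.eq, hB.1.eq] at this
  rw [h2, Matrix.toLin'_mul]
  exact LinearMap.range_comp_le_range _ _

open scoped MatrixOrder Matrix.Norms.L2Operator in
theorem aux_bound {d : ℕ} (P : Matrix (Fin d) (Fin d) ℂ) (hP : P.PosSemidef) :
    ∃ c : ℝ, 0 ≤ c ∧ (c • (1 : Matrix (Fin d) (Fin d) ℂ) - P).PosSemidef := by
  refine ⟨‖P‖, norm_nonneg _, ?_⟩
  have := IsSelfAdjoint.le_algebraMap_norm_self (a := P) hP.1
  rwa [Algebra.algebraMap_eq_smul_one, Matrix.le_iff] at this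

open scoped MatrixOrder in
theorem aux_sq {d : ℕ} {A : Matrix (Fin d) (Fin d) ℂ} (hA : A.PosSemidef) :
    ∃ S : Matrix (Fin d) (Fin d) ℂ, A = Sᴴ * S :=
  CStarAlgebra.nonneg_iff_eq_star_mul_self.mp hA.nonneg

theorem aux_dom {d : ℕ} {A B : Matrix (Fin d) (Fin d) ℂ} (hA : A.PosSemidef)
    (hB : B.PosSemidef)
    (h : LinearMap.range (Matrix.toLin' A) ≤ LinearMap.range (Matrix.toLin' B)) :
    ∃ c : ℝ, 0 ≤ c ∧ (c • B - A).PosSemidef := by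
  have hk : ∀ x, B *ᵥ x = 0 → A *ᵥ x = 0 := by
    intro x hx
    rw [← hA.dotProduct_mulVec_zero_iff]
    obtain ⟨y, hy⟩ := h ⟨x, rfl⟩
    rw [Matrix.toLin'_apply, Matrix.toLin'_apply] at hy
    rw [← hy, dotProduct_mulVec, ← hB.1.eq, ← star_mulVec, hx, star_zero, zero_dotProduct]
  obtain ⟨S, hS⟩ := aux_sq hA
  obtain ⟨R, hR⟩ := aux_sq hB
  obtain ⟨T, hT⟩ := aux_factor R S (by
    intro x hx
    rw [← conjTranspose_mul_self_mulVec_eq_zero, ← hS]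
    apply hk
    rw [hR, conjTranspose_mul_self_mulVec_eq_zero, hx])
  obtain ⟨c, hc, hc2⟩ := aux_bound (Tᴴ * T) (posSemidef_conjTranspose_mul_self T)
  refine ⟨c, hc, ?_⟩
  have h3 := hc2.conjTranspose_mul_mul_same R
  have h4 : Rᴴ * (c • (1 : Matrix (Fin d) (Fin d) ℂ) - Tᴴ * T) * R = c • B - A := by
    rw [hS, hR, hT, conjTranspose_mul]
    simp [mul_sub, sub_mul, mul_assoc]
  rwa [h4] at h3

theorem aux_dom_all {d n : ℕ} {A B : Fin n → Matrix (Fin d) (Fin d) ℂ}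
    (hA : ∀ i, (A i).PosSemidef) (hB : ∀ i, (B i).PosSemidef)
    (h : ∀ i, LinearMap.range (Matrix.toLin' (A i)) ≤ LinearMap.range (Matrix.toLin' (B i))) :
    ∃ c : ℝ, 0 ≤ c ∧ ∀ i, (c • B i - A i).PosSemidef := by
  choose c hc hc2 using fun i => aux_dom (hA i) (hB i) (h i)
  refine ⟨∑ i, c i, Finset.sum_nonneg fun i _ => hc i, fun i => ?_⟩
  have hle : 0 ≤ (∑ i, c i) - c i :=
    sub_nonneg.mpr (Finset.single_le_sum (fun i _ => hc i) (Finset.mem_univ i))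
  have h5 := ((hB i).smul hle).add (hc2 i)
  have h6 : ((∑ i, c i) - c i) • B i + (c i • B i - A i) = (∑ i, c i) • B i - A i := by
    rw [sub_smul]; abel
  rwa [h6] at h5

/-- Theorem 6(i): the projective robustness of a POVM is finite iff some free POVM has
effects with exactly the same ranges. -/
theorem projective_robustness_measurement_finite_iff
    (d n : ℕ) (hd : 0 < d) (hn : 0 < n)
    (MF : Set (Fin n → Matrix (Fin d) (Fin d) ℂ)) (hMF : ∀ N ∈ MF, IsPOVM N)
    (M : Fin n → Matrix (Fin d) (Fin d) ℂ) (hM : IsPOVM M) :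
    OmegaM MF M ≠ ⊤ ↔
      ∃ N ∈ MF, ∀ i, LinearMap.range (Matrix.toLin' (N i)) =
        LinearMap.range (Matrix.toLin' (M i)) := by
  constructor
  · intro h
    by_contra hne
    apply h
    unfold OmegaM
    rw [sInf_eq_top]
    rintro γ ⟨lam, mu, _, _, ⟨N, hN, hi⟩, _⟩
    exact absurd ⟨N, hN, fun i => le_antisymm
      (aux_range ((hMF N hN).1 i) (hM.1 i) mu (hi i).2)
      (aux_range (hM.1 i) ((hMF N hN).1 i) lam (hi i).1)⟩ hne
  · rintro ⟨N, hN, hr⟩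
    obtain ⟨lam, hl, hl2⟩ := aux_dom_all hM.1 (hMF N hN).1 (fun i => (hr i).ge)
    obtain ⟨mu, hm, hm2⟩ := aux_dom_all (hMF N hN).1 hM.1 (fun i => (hr i).le)
    exact ne_top_of_le_ne_top ENNReal.ofReal_ne_top
      (sInf_le ⟨lam, mu, hl, hm, ⟨N, hN, fun i => ⟨hl2 i, hm2 i⟩⟩, rfl⟩)
end

section
/- Fix positive integers d and n, let ℳF be a nonempty compact convex set of POVMs with n outcomes on ℂ^d, and let M be a POVM. For an ensemble consisting of weights p : Fin n → ℝ with p i ≥ 0 and ∑ p i = 1 together with density matrices σ : Fin n → Matrix (Fin d) (Fin d) ℂ, and a POVM N, define the success probability P(p,σ,N) := ∑_i p i · Tr((N i)·(σ i)) (a real number). Then Ω_{ℳF}(M) equals the supremum, taken over all pairs of ensembles (p,σ) and (q,τ) (both indexed by Fin n) such that P(p,σ,M) > 0, P(q,τ,M) > 0, and P(p,σ,N) > 0 and P(q,τ,N) > 0 for every N ∈ ℳF, of the ratio [P(p,σ,M)/P(q,τ,M)] / [sup_{N ∈ ℳF} P(p,σ,N)/P(q,τ,N)], the equality understood in [0,∞].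 (Theorem 7: the projective robustness of measurements quantifies the maximal advantage of M over all free measurements in simultaneous discrimination of the ensemble (p,σ) and exclusion of the ensemble (q,τ).) -/
open Matrix ComplexOrder

/-- The success probability of discriminating the ensemble {pᵢ, σᵢ} with the POVM N. -/
noncomputable def psuccM {d n : ℕ} (p : Fin n → ℝ)
    (σ : Fin n → Matrix (Fin d) (Fin d) ℂ)
    (N : Fin n → Matrix (Fin d) (Fin d) ℂ) : ℝ :=
  ∑ i, p i * ((N i * σ i).trace).re


/-- Pairing of two families of matrices. -/
noncomputable def pairM {d n : ℕ} (A N : Fin n → Matrix (Fin d) (Fin d) ℂ) : ℝ :=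
  ∑ i, ((N i * A i).trace).re

lemma pairM_sub {d n : ℕ} (A X Y : Fin n → Matrix (Fin d) (Fin d) ℂ) :
    pairM A (X - Y) = pairM A X - pairM A Y := by
  simp [pairM, sub_mul, Finset.sum_sub_distrib]

lemma pairM_smul {d n : ℕ} (A X : Fin n → Matrix (Fin d) (Fin d) ℂ) (t : ℝ) :
    pairM A (t • X) = t * pairM A X := by
  simp [pairM, Finset.mul_sum, Matrix.trace_smul]

lemma psd_trace_nonneg {d : ℕ} {A B : Matrix (Fin d) (Fin d) ℂ} (hA : A.PosSemidef)
    (hB : B.PosSemidef) : 0 ≤ ((A * B).trace).re := by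
  obtain ⟨C, rfl⟩ : ∃ C : Matrix (Fin d) (Fin d) ℂ, B = Cᴴ * C := by
    open scoped MatrixOrder in
    exact CStarAlgebra.nonneg_iff_eq_star_mul_self.mp hB.nonneg
  rw [← Matrix.mul_assoc, Matrix.trace_mul_comm, ← Matrix.mul_assoc]
  have := (hA.mul_mul_conjTranspose_same C).trace_nonneg
  exact (Complex.le_def.mp this).1

lemma pairM_nonneg {d n : ℕ} {A X : Fin n → Matrix (Fin d) (Fin d) ℂ}
    (hA : ∀ i, (A i).PosSemidef) (hX : ∀ i, (X i).PosSemidef) : 0 ≤ pairM A X :=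
  Finset.sum_nonneg fun i _ => psd_trace_nonneg (hX i) (hA i)

lemma pairM_add_one {d n : ℕ} {A N : Fin n → Matrix (Fin d) (Fin d) ℂ} (hN : IsPOVM N) (t : ℝ) :
    pairM (fun i => A i + t • (1 : Matrix (Fin d) (Fin d) ℂ)) N = pairM A N + t * d := by
  have h : ∑ i, ((N i).trace).re = d := by
    have := congrArg (fun X => (Matrix.trace X).re) hN.2
    simpa [Matrix.trace_sum] using this
  simp [pairM, mul_add, Finset.sum_add_distrib, Matrix.trace_smul, ← Finset.mul_sum, h]

lemma functional_rep1 {d : ℕ} (f : Matrix (Fin d) (Fin d) ℂ →ₗ[ℝ] ℝ)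
    (hf : ∀ X : Matrix (Fin d) (Fin d) ℂ, X.PosSemidef → 0 ≤ f X) :
    ∃ A : Matrix (Fin d) (Fin d) ℂ, A.PosSemidef ∧
      ∀ X : Matrix (Fin d) (Fin d) ℂ, X.IsHermitian → f X = ((X * A).trace).re := by
  let A : Matrix (Fin d) (Fin d) ℂ := fun j i =>
    (f (Matrix.single i j 1) : ℂ) - Complex.I * (f (Matrix.single i j Complex.I) : ℂ)
  have hA : ∀ X, f X = ((X * A).trace).re := by
    intro X
    conv_lhs => rw [Matrix.matrix_eq_sum_single X]
    simp only [map_sum, Matrix.trace, Matrix.diag, Matrix.mul_apply, Complex.re_sum]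
    refine Finset.sum_congr rfl fun i _ => Finset.sum_congr rfl fun j _ => ?_
    have : Matrix.single i j (X i j) = (X i j).re • Matrix.single i j (1:ℂ)
        + (X i j).im • Matrix.single i j Complex.I := by
      rw [Matrix.smul_single, Matrix.smul_single, ← Matrix.single_add]
      congr 1
      apply Complex.ext <;> simp
    rw [this, map_add, map_smul, map_smul]
    simp [A]
  have hB : ∀ X : Matrix (Fin d) (Fin d) ℂ, X.IsHermitian →
      f X = ((X * ((1/2 : ℝ) • (A + Aᴴ))).trace).re := by
    intro X hX
    have h2 : ((X * Aᴴ).trace).re = ((X * A).trace).re := by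
      have : X * Aᴴ = (A * X)ᴴ := by rw [Matrix.conjTranspose_mul, hX.eq]
      rw [this, Matrix.trace_conjTranspose, Matrix.trace_mul_comm]
      simp
    rw [hA X]
    simp only [Matrix.mul_smul, mul_add, Matrix.trace_smul, Matrix.trace_add, Complex.add_re,
      Complex.smul_re, h2, smul_eq_mul]
    ring
  refine ⟨(1/2 : ℝ) • (A + Aᴴ), ?_, hB⟩
  have hH : ((1/2 : ℝ) • (A + Aᴴ)).IsHermitian := by
    unfold Matrix.IsHermitian
    rw [Matrix.conjTranspose_smul, Matrix.conjTranspose_add, Matrix.conjTranspose_conjTranspose,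
      add_comm]
    simp
  refine Matrix.PosSemidef.of_dotProduct_mulVec_nonneg hH fun x => ?_
  have hp := Matrix.posSemidef_vecMulVec_self_star x
  have h := hf _ hp
  rw [hB _ hp.isHermitian] at h
  rw [Matrix.vecMulVec_mul, Matrix.trace_vecMulVec, dotProduct_comm, ← Matrix.dotProduct_mulVec] at h
  rw [Complex.le_def]
  refine ⟨by simpa using h, ?_⟩
  have := hH.im_star_dotProduct_mulVec_self x
  simpa using this.symm

lemma functional_rep {d n : ℕ} (f : (Fin n → Matrix (Fin d) (Fin d) ℂ) →ₗ[ℝ] ℝ)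
    (hf : ∀ X, (∀ i, (X i).PosSemidef) → 0 ≤ f X) :
    ∃ A : Fin n → Matrix (Fin d) (Fin d) ℂ, (∀ i, (A i).PosSemidef) ∧
      ∀ X, (∀ i, (X i).IsHermitian) → f X = pairM A X := by
  classical
  have h : ∀ i, ∃ A : Matrix (Fin d) (Fin d) ℂ, A.PosSemidef ∧
      ∀ X : Matrix (Fin d) (Fin d) ℂ, X.IsHermitian →
        f (Pi.single i X) = ((X * A).trace).re := by
    intro i
    refine functional_rep1 (d := d) (f.comp (LinearMap.single ℝ (fun _ : Fin n => Matrix (Fin d) (Fin d) ℂ) i)) fun X hX => hf _ fun j => ?_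
    by_cases hij : j = i
    · subst hij; simpa using hX
    · simpa [hij] using Matrix.PosSemidef.zero
  choose A hA hAf using h
  refine ⟨A, hA, fun X hX => ?_⟩
  conv_lhs => rw [← Finset.univ_sum_single X]
  rw [map_sum]
  exact Finset.sum_congr rfl fun i _ => hAf i _ (hX i)

lemma isClosed_psd {d : ℕ} : IsClosed {X : Matrix (Fin d) (Fin d) ℂ | X.PosSemidef} := by
  have : {X : Matrix (Fin d) (Fin d) ℂ | X.PosSemidef} =
      {X | Xᴴ = X} ∩ ⋂ x : Fin d → ℂ, {X | 0 ≤ star x ⬝ᵥ (X *ᵥ x)} := by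
    ext X
    simp [Matrix.posSemidef_iff_dotProduct_mulVec, Matrix.IsHermitian]
  rw [this]
  refine (isClosed_eq (by fun_prop) (by fun_prop)).inter (isClosed_iInter fun x => ?_)
  exact isClosed_le continuous_const (by fun_prop)

lemma psd_real_smul {d : ℕ} {X : Matrix (Fin d) (Fin d) ℂ} (h : X.PosSemidef) {t : ℝ}
    (ht : 0 ≤ t) : (t • X).PosSemidef := by
  have := h.smul (a := (t : ℂ)) (by exact_mod_cast ht)
  convert this using 1
  ext i j
  simp

/-- the separation step -/
lemma separation {d n : ℕ} (MF : Set (Fin n → Matrix (Fin d) (Fin d) ℂ))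
    (hne : MF.Nonempty) (hc : IsCompact MF) (hconv : Convex ℝ MF)
    (hMF : ∀ N ∈ MF, IsPOVM N)
    (M : Fin n → Matrix (Fin d) (Fin d) ℂ) (hM : IsPOVM M) (c T : ℝ) (hT : 0 ≤ T)
    (hno : ∀ N ∈ MF, ∀ t : ℝ, 0 ≤ t →
      ¬ ∀ i, (t • N i - M i).PosSemidef ∧ (c • M i - t • N i).PosSemidef) :
    ∃ A B : Fin n → Matrix (Fin d) (Fin d) ℂ, (∀ i, (A i).PosSemidef) ∧
      (∀ i, (B i).PosSemidef) ∧ ∀ N ∈ MF, ∀ t : ℝ, 0 ≤ t → t ≤ T →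
        t * (pairM A N - pairM B N) < pairM A M - c * pairM B M := by
  haveI : LocallyConvexSpace ℝ (Matrix (Fin d) (Fin d) ℂ) :=
    inferInstanceAs (LocallyConvexSpace ℝ (Fin d → Fin d → ℂ))
  let V := Fin n → Matrix (Fin d) (Fin d) ℂ
  let S : Set V := (fun x : ℝ × V => x.1 • x.2) '' (Set.Icc 0 T ×ˢ MF)
  have hSc : IsCompact S := (isCompact_Icc.prod hc).image (by fun_prop)
  have hSconv : Convex ℝ S := by
    rintro _ ⟨⟨t₁, N₁⟩, ⟨⟨h1, h1'⟩, hN1⟩, rfl⟩ _ ⟨⟨t₂, N₂⟩, ⟨⟨h2, h2'⟩, hN2⟩, rfl⟩ a b ha hb hab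
    simp only at h1 h1' h2 h2' hN1 hN2 ⊢
    have e1 : 0 ≤ a * t₁ := mul_nonneg ha h1
    have e2 : 0 ≤ b * t₂ := mul_nonneg hb h2
    rcases (add_nonneg e1 e2).eq_or_lt with h0 | hpos
    · have z1 : a * t₁ = 0 := by linarith
      have z2 : b * t₂ = 0 := by linarith
      refine ⟨(0, N₁), ⟨⟨le_rfl, hT⟩, hN1⟩, ?_⟩
      simp [smul_smul, z1, z2]
    · refine ⟨(a * t₁ + b * t₂, (a * t₁ / (a * t₁ + b * t₂)) • N₁
        + (b * t₂ / (a * t₁ + b * t₂)) • N₂), ⟨⟨hpos.le, ?_⟩, ?_⟩, ?_⟩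
      · simp only
        nlinarith
      · exact hconv hN1 hN2 (by positivity) (by positivity) (by field_simp)
      · simp only [smul_add, smul_smul]
        rw [mul_div_cancel₀ _ hpos.ne', mul_div_cancel₀ _ hpos.ne']
  let K : Set (V × V) := (fun X : V => (X - M, c • M - X)) '' S
  have hKc : IsCompact K := hSc.image (by fun_prop)
  have hKconv : Convex ℝ K := by
    rintro _ ⟨X, hX, rfl⟩ _ ⟨Y, hY, rfl⟩ a b ha hb hab
    refine ⟨a • X + b • Y, hSconv hX hY ha hb hab, ?_⟩
    have hb' : b = 1 - a := by linarith
    subst hb'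
    ext1
    · simp only [Prod.fst_add, Prod.smul_fst]; module
    · simp only [Prod.snd_add, Prod.smul_snd]; module
  let P : Set (V × V) := {x | (∀ i, (x.1 i).PosSemidef) ∧ ∀ i, (x.2 i).PosSemidef}
  have hPclosed : IsClosed P := by
    have : P = (⋂ i, {x | (x.1 i).PosSemidef}) ∩ ⋂ i, {x | (x.2 i).PosSemidef} := by
      ext x; simp [P]
    rw [this]
    refine (isClosed_iInter fun i => ?_).inter (isClosed_iInter fun i => ?_)
    · exact isClosed_psd.preimage (f := fun x : V × V => x.1 i) (by fun_prop)
    · exact isClosed_psd.preimage (f := fun x : V × V => x.2 i) (by fun_prop)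
  have hPsmul : ∀ x ∈ P, ∀ t : ℝ, 0 ≤ t → t • x ∈ P := fun x hx t ht =>
    ⟨fun i => psd_real_smul (hx.1 i) ht, fun i => psd_real_smul (hx.2 i) ht⟩
  have hPadd : ∀ x ∈ P, ∀ y ∈ P, x + y ∈ P := fun x hx y hy =>
    ⟨fun i => (hx.1 i).add (hy.1 i), fun i => (hx.2 i).add (hy.2 i)⟩
  have hPconv : Convex ℝ P := fun x hx y hy a b ha hb _ =>
    hPadd _ (hPsmul x hx a ha) _ (hPsmul y hy b hb)
  have hdisj : Disjoint K P := by
    rw [Set.disjoint_left]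
    rintro _ ⟨_, ⟨⟨t, N⟩, ⟨⟨ht, _⟩, hN⟩, rfl⟩, rfl⟩ hx
    exact hno N hN t ht fun i => ⟨hx.1 i, hx.2 i⟩
  obtain ⟨f, u, v, hfu, huv, hfv⟩ :=
    geometric_hahn_banach_compact_closed hKconv hKc hPconv hPclosed hdisj
  have h0P : (0 : V × V) ∈ P := ⟨fun i => Matrix.PosSemidef.zero, fun i => Matrix.PosSemidef.zero⟩
  have hv0 : v < 0 := by simpa using hfv 0 h0P
  have hfP : ∀ x ∈ P, 0 ≤ f x := by
    intro x hx
    by_contra! hneg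
    have := hfv _ (hPsmul x hx (v / f x) (div_nonneg_of_nonpos hv0.le hneg.le))
    rw [map_smul, smul_eq_mul, div_mul_cancel₀ _ hneg.ne] at this
    exact lt_irrefl _ this
  obtain ⟨A, hA, hAf⟩ := functional_rep (f.toLinearMap.comp (LinearMap.inl ℝ V V))
    fun X hX => hfP _ ⟨hX, fun i => Matrix.PosSemidef.zero⟩
  obtain ⟨B, hB, hBf⟩ := functional_rep (f.toLinearMap.comp (LinearMap.inr ℝ V V))
    fun X hX => hfP _ ⟨fun i => Matrix.PosSemidef.zero, hX⟩
  refine ⟨A, B, hA, hB, fun N hN t ht htT => ?_⟩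
  have h := hfu _ ⟨_, ⟨(t, N), ⟨⟨ht, htT⟩, hN⟩, rfl⟩, rfl⟩
  have hMh : ∀ i, (M i).IsHermitian := fun i => (hM.1 i).isHermitian
  have hNh : ∀ i, (t • N i).IsHermitian := fun i =>
    (psd_real_smul ((hMF N hN).1 i) ht).isHermitian
  have hMh' : ∀ i, (c • M i).IsHermitian := fun i => by
    rw [Matrix.IsHermitian, Matrix.conjTranspose_smul, (hMh i).eq]; simp
  have e1 := hAf (t • N - M) fun i => (hNh i).sub (hMh i)
  have e2 := hBf (c • M - t • N) fun i => (hMh' i).sub (hNh i)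
  rw [pairM_sub, pairM_smul] at e1
  rw [pairM_sub, pairM_smul, pairM_smul] at e2
  have e3 : ((t • N - M, c • M - t • N) : V × V) =
    LinearMap.inl ℝ V V (t • N - M) + LinearMap.inr ℝ V V (c • M - t • N) := by simp
  simp only at h
  rw [e3, map_add] at h
  simp only [LinearMap.comp_apply, ContinuousLinearMap.coe_coe] at e1 e2
  rw [e1, e2] at h
  linarith

/-- normalization of a family of PSD matrices to an ensemble -/
lemma normalizeM {d n : ℕ} (hn : 0 < n) (A : Fin n → Matrix (Fin d) (Fin d) ℂ)
    (hA : ∀ i, (A i).PosSemidef) (hA' : ∀ i, 0 < ((A i).trace).re) :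
    ∃ (p : Fin n → ℝ) (σ : Fin n → Matrix (Fin d) (Fin d) ℂ) (a : ℝ), 0 < a ∧
      (∀ i, 0 ≤ p i) ∧ (∑ i, p i) = 1 ∧ (∀ i, (σ i).PosSemidef ∧ (σ i).trace = 1) ∧
      ∀ N, psuccM p σ N = pairM A N / a := by
  haveI : Nonempty (Fin n) := ⟨⟨0, hn⟩⟩
  have ha : 0 < ∑ i, ((A i).trace).re := Finset.sum_pos (fun i _ => hA' i) Finset.univ_nonempty
  refine ⟨fun i => ((A i).trace).re / ∑ i, ((A i).trace).re,
    fun i => (((A i).trace).re)⁻¹ • A i, ∑ i, ((A i).trace).re, ha, ?_, ?_, ?_, ?_⟩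
  · exact fun i => div_nonneg (hA' i).le ha.le
  · rw [← Finset.sum_div, div_self ha.ne']
  · intro i
    refine ⟨psd_real_smul (hA i) (inv_nonneg.mpr (hA' i).le), ?_⟩
    have him : ((A i).trace).im = 0 := (Complex.le_def.mp (hA i).trace_nonneg).2.symm
    rw [Matrix.trace_smul]
    apply Complex.ext
    · simp [(hA' i).ne']
    · simp [him]
  · intro N
    simp only [psuccM, pairM, Finset.sum_div]
    refine Finset.sum_congr rfl fun i _ => ?_
    have := (hA' i).ne'
    simp only [Matrix.mul_smul, Matrix.trace_smul, Complex.smul_re, smul_eq_mul]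
    field_simp

lemma psuccM_continuous {d n : ℕ} (p : Fin n → ℝ) (σ : Fin n → Matrix (Fin d) (Fin d) ℂ) :
    Continuous (psuccM p σ) := by
  unfold psuccM
  refine continuous_finsetSum _ fun i _ => continuous_const.mul
    (Complex.continuous_re.comp ?_)
  exact Continuous.matrix_trace (by fun_prop)

lemma psuccM_le {d n : ℕ} {p : Fin n → ℝ} {σ : Fin n → Matrix (Fin d) (Fin d) ℂ}
    (hp : ∀ i, 0 ≤ p i) (hσ : ∀ i, (σ i).PosSemidef) {X Y : Fin n → Matrix (Fin d) (Fin d) ℂ}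
    {t : ℝ} (h : ∀ i, (t • Y i - X i).PosSemidef) : psuccM p σ X ≤ t * psuccM p σ Y := by
  unfold psuccM
  rw [Finset.mul_sum]
  refine Finset.sum_le_sum fun i _ => ?_
  have := psd_trace_nonneg (h i) (hσ i)
  rw [sub_mul, Matrix.trace_sub, Matrix.smul_mul, Matrix.trace_smul, Complex.sub_re,
    Complex.smul_re, smul_eq_mul] at this
  nlinarith [mul_nonneg (hp i) this]

/-- Theorem 7: the projective robustness of a measurement quantifies the maximal
advantage it gives over all free measurements in simultaneous discrimination of one
fixed state ensemble and exclusion of another. -/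
theorem projective_robustness_measurement_discrimination
    (d n : ℕ) (hd : 0 < d) (hn : 0 < n)
    (MF : Set (Fin n → Matrix (Fin d) (Fin d) ℂ))
    (hne : MF.Nonempty) (hc : IsCompact MF) (hconv : Convex ℝ MF)
    (hMF : ∀ N ∈ MF, IsPOVM N)
    (M : Fin n → Matrix (Fin d) (Fin d) ℂ) (hM : IsPOVM M) :
    OmegaM MF M = sSup {γ : ENNReal |
      ∃ p q : Fin n → ℝ, ∃ σ τ : Fin n → Matrix (Fin d) (Fin d) ℂ,
        (∀ i, 0 ≤ p i) ∧ (∑ i, p i) = 1 ∧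
        (∀ i, (σ i).PosSemidef ∧ (σ i).trace = 1) ∧
        (∀ i, 0 ≤ q i) ∧ (∑ i, q i) = 1 ∧
        (∀ i, (τ i).PosSemidef ∧ (τ i).trace = 1) ∧
        0 < psuccM p σ M ∧ 0 < psuccM q τ M ∧
        (∀ N ∈ MF, 0 < psuccM p σ N ∧ 0 < psuccM q τ N) ∧
        γ = ENNReal.ofReal ((psuccM p σ M / psuccM q τ M) /
          sSup {r : ℝ | ∃ N ∈ MF, r = psuccM p σ N / psuccM q τ N})} := by
  apply le_antisymm
  · refine le_of_forall_lt fun c hcΩ => ?_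
    obtain ⟨c', hcc', hc'Ω⟩ := exists_between hcΩ
    refine hcc'.trans_le ?_
    have hc'top : c' ≠ ⊤ := ne_top_of_lt hc'Ω
    clear hcΩ hcc' c
    obtain ⟨c, hc0, rfl⟩ : ∃ c : ℝ, 0 ≤ c ∧ c' = ENNReal.ofReal c :=
      ⟨c'.toReal, ENNReal.toReal_nonneg, (ENNReal.ofReal_toReal hc'top).symm⟩
    have hd' : (0 : ℝ) < d := by exact_mod_cast hd
    have hno : ∀ N ∈ MF, ∀ t : ℝ, 0 ≤ t →
        ¬ ∀ i, (t • N i - M i).PosSemidef ∧ (c • M i - t • N i).PosSemidef := by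
      intro N hN t ht h
      rcases ht.eq_or_lt with rfl | htpos
      · have hs : ∀ i, (-(M i)).PosSemidef := fun i => by simpa using (h i).1
        have h1 : 0 ≤ ((∑ i, -(M i)).trace).re := by
          rw [Matrix.trace_sum, Complex.re_sum]
          exact Finset.sum_nonneg fun i _ => (Complex.le_def.mp (hs i).trace_nonneg).1
        rw [Finset.sum_neg_distrib, hM.2] at h1
        simp at h1
        omega
      · refine not_le.mpr hc'Ω (sInf_le ⟨t, t⁻¹ * c, ht, by positivity, ⟨N, hN, fun i =>
          ⟨(h i).1, ?_⟩⟩, ?_⟩)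
        · have := psd_real_smul (h i).2 (inv_nonneg.mpr ht)
          rwa [smul_sub, smul_smul, smul_smul, inv_mul_cancel₀ htpos.ne', one_smul] at this
        · rw [mul_inv_cancel_left₀ htpos.ne']
    obtain ⟨A, B, hA, hB, hAB⟩ :=
      separation MF hne hc hconv hMF M hM c (c + 1) (by positivity) hno
    obtain ⟨N₀, hN₀⟩ := hne
    set δ := pairM A M - c * pairM B M with hδdef
    have hδ : 0 < δ := by simpa using hAB N₀ hN₀ 0 le_rfl (by positivity)
    -- shifts
    let η : ℝ := δ / (c + 1) ^ 2
    have hη : 0 < η := by positivity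
    let ε : ℝ := δ / (c + 1)
    have hε : 0 < ε := by positivity
    let A' := fun i => A i + (η / d) • (1 : Matrix (Fin d) (Fin d) ℂ)
    let B' := fun i => B i + ((η + ε) / d) • (1 : Matrix (Fin d) (Fin d) ℂ)
    have hpos : ∀ {X : Matrix (Fin d) (Fin d) ℂ} {t : ℝ}, X.PosSemidef → 0 < t →
        (X + t • (1 : Matrix (Fin d) (Fin d) ℂ)).PosSemidef ∧
        0 < ((X + t • (1 : Matrix (Fin d) (Fin d) ℂ)).trace).re := by
      intro X t hX ht
      refine ⟨hX.add (psd_real_smul (Matrix.PosSemidef.one (n := Fin d) (R := ℂ)) ht.le), ?_⟩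
      have := (Complex.le_def.mp hX.trace_nonneg).1
      have h2 : 0 < t * d := by positivity
      simp [Matrix.trace_add, Matrix.trace_smul] at this ⊢
      linarith
    have hηd : 0 < η / d := by positivity
    have hεd : 0 < (η + ε) / d := by positivity
    obtain ⟨p, σ, a, ha, hp, hp1, hσ, hpA⟩ := normalizeM hn A'
      (fun i => (hpos (hA i) hηd).1) (fun i => (hpos (hA i) hηd).2)
    obtain ⟨q, τ, b, hb, hq, hq1, hτ, hqB⟩ := normalizeM hn B'
      (fun i => (hpos (hB i) hεd).1) (fun i => (hpos (hB i) hεd).2)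
    have eA : ∀ N, IsPOVM N → pairM A' N = pairM A N + η := fun N hN => by
      rw [pairM_add_one hN, div_mul_cancel₀ _ hd'.ne']
    have eB : ∀ N, IsPOVM N → pairM B' N = pairM B N + (η + ε) := fun N hN => by
      rw [pairM_add_one hN, div_mul_cancel₀ _ hd'.ne']
    have pA : ∀ N, IsPOVM N → 0 < pairM A' N := fun N hN => by
      rw [eA N hN]; have := pairM_nonneg hA hN.1; positivity
    have pB : ∀ N, IsPOVM N → 0 < pairM B' N := fun N hN => by
      rw [eB N hN]; have := pairM_nonneg hB hN.1; positivity
    have hNle : ∀ N ∈ MF, pairM A' N ≤ pairM B' N := by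
      intro N hN
      rw [eA N (hMF N hN), eB N (hMF N hN)]
      have := hAB N hN (c + 1) (by positivity) le_rfl
      have h2 : pairM A N - pairM B N < ε := by
        rw [lt_div_iff₀ (by positivity)]; linarith
      linarith
    have hMge : c * pairM B' M ≤ pairM A' M := by
      rw [eA M hM, eB M hM]
      have : c * (η + ε) ≤ δ + η := by
        have e1 : δ = (c + 1) ^ 2 * η := by simp only [η]; field_simp
        have e2 : ε = (c + 1) * η := by simp only [η, ε]; field_simp
        rw [e2, e1]
        nlinarith
      linarith
    refine le_sSup_of_le ⟨p, q, σ, τ, hp, hp1, hσ, hq, hq1, hτ, ?_, ?_, ?_, rfl⟩ ?_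
    · rw [hpA]; exact div_pos (pA M hM) ha
    · rw [hqB]; exact div_pos (pB M hM) hb
    · intro N hN
      rw [hpA, hqB]
      exact ⟨div_pos (pA N (hMF N hN)) ha, div_pos (pB N (hMF N hN)) hb⟩
    · apply ENNReal.ofReal_le_ofReal
      have hub : ∀ r ∈ {r : ℝ | ∃ N ∈ MF, r = psuccM p σ N / psuccM q τ N}, r ≤ b / a := by
        rintro r ⟨N, hN, rfl⟩
        rw [hpA, hqB, div_div_div_eq, div_le_div_iff₀
          (mul_pos ha (pB N (hMF N hN))) ha]
        nlinarith [mul_le_mul_of_nonneg_left (hNle N hN) (mul_pos ha hb).le]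
      have hmem : psuccM p σ N₀ / psuccM q τ N₀ ∈
        {r : ℝ | ∃ N ∈ MF, r = psuccM p σ N / psuccM q τ N} := ⟨N₀, hN₀, rfl⟩
      have hsle := csSup_le ⟨_, hmem⟩ hub
      have hspos : 0 < sSup {r : ℝ | ∃ N ∈ MF, r = psuccM p σ N / psuccM q τ N} := by
        refine lt_of_lt_of_le ?_ (le_csSup ⟨_, hub⟩ hmem)
        rw [hpA, hqB]
        exact div_pos (div_pos (pA _ (hMF _ hN₀)) ha) (div_pos (pB _ (hMF _ hN₀)) hb)
      rw [le_div_iff₀ hspos]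
      refine (mul_le_mul_of_nonneg_left hsle hc0).trans ?_
      rw [hpA, hqB, div_div_div_eq, ← mul_div_assoc, div_le_div_iff₀ ha (mul_pos ha (pB M hM))]
      nlinarith [mul_le_mul_of_nonneg_left hMge (mul_pos ha hb).le]
  · refine sSup_le ?_
    rintro _ ⟨p, q, σ, τ, hp, hp1, hσ, hq, hq1, hτ, hpM, hqM, hN, rfl⟩
    refine le_sInf ?_
    rintro _ ⟨lam, mu, hlam, hmu, ⟨N, hNF, h⟩, rfl⟩
    apply ENNReal.ofReal_le_ofReal
    obtain ⟨h1, h2⟩ := hN N hNF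
    have hbdd : BddAbove {r : ℝ | ∃ N ∈ MF, r = psuccM p σ N / psuccM q τ N} := by
      have hcont : ContinuousOn (fun N => psuccM p σ N / psuccM q τ N) MF :=
        (psuccM_continuous p σ).continuousOn.div (psuccM_continuous q τ).continuousOn
          fun N hN' => (hN N hN').2.ne'
      refine (hc.bddAbove_image hcont).mono ?_
      rintro r ⟨N, hN', rfl⟩
      exact ⟨N, hN', rfl⟩
    have hle : psuccM p σ N / psuccM q τ N ≤ _ := le_csSup hbdd ⟨N, hNF, rfl⟩
    have hspos := (div_pos h1 h2).trans_le hle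
    rw [div_le_iff₀ hspos]
    refine le_trans ?_ (mul_le_mul_of_nonneg_left hle (mul_nonneg hlam hmu))
    have a1 := psuccM_le hp (fun i => (hσ i).1) fun i => (h i).1
    have a2 := psuccM_le hq (fun i => (hτ i).1) fun i => (h i).2
    rw [← mul_div_assoc, div_le_div_iff₀ hqM h2]
    calc psuccM p σ M * psuccM q τ N ≤ (lam * psuccM p σ N) * (mu * psuccM q τ M) :=
          mul_le_mul a1 a2 h2.le (mul_nonneg hlam h1.le)
      _ = _ := by ring
end
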